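/- arXiv:1106.2839 — 3 statements merged into one kernel-verified Lean document; each statement's English description precedes it below -/
import Mathlib

section
/- Let w ∈ S_N. If there exist distinct k, k' ∈ newrep(w) with 𝔭_k(w) = 𝔭_{k'}(w), then w has an N-occurrence of the pattern 4321. -/
/-!
Common framework.  Permutations of `{1, …, m}` are modelled as `Equiv.Perm (Fin m)`
with 0-based positions and values.  The simple reflection `sr m i` (for
`0 ≤ i ≤ m - 2`, corresponding to the paper's `s_{i+1}`) swaps the values `i` and
`i + 1`.  Cut statistics `Mstat w k` / `mstat w k` (the paper's `M_{k+1}`/`m_{k+1}`)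
are respectively the maximum of the first `k + 1` entries and the minimum of the
remaining entries of the one-line notation of `w`.
-/

/-- The simple reflection swapping `i` and `i + 1` (0-based) in the symmetric group
on `Fin m`; the identity if out of range. -/
def sr (m i : ℕ) : Equiv.Perm (Fin m) :=
  if h : i + 1 < m then Equiv.swap ⟨i, Nat.lt_of_succ_lt h⟩ ⟨i + 1, h⟩ else 1

/-- `l` is a word in the simple reflections whose product is `w`. -/
def IsWord (m : ℕ) (l : List ℕ) (w : Equiv.Perm (Fin m)) : Prop :=
  (∀ i ∈ l, i + 1 < m) ∧ (l.map (sr m)).prod = w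

/-- The Coxeter length `ℓ(w)`: the minimal length of a word expressing `w`. -/
noncomputable def len {m : ℕ} (w : Equiv.Perm (Fin m)) : ℕ :=
  sInf {c | ∃ l : List ℕ, IsWord m l w ∧ l.length = c}

/-- `l` is a reduced decomposition of `w`. -/
def IsReducedWord {m : ℕ} (w : Equiv.Perm (Fin m)) (l : List ℕ) : Prop :=
  IsWord m l w ∧ l.length = len w

/-- The support of `w`: the letters appearing in some reduced decomposition. -/
noncomputable def supp {m : ℕ} (w : Equiv.Perm (Fin m)) : Set ℕ :=
  {i | ∃ l : List ℕ, IsReducedWord w l ∧ i ∈ l}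

/-- `rep w = ℓ(w) - |supp w|`, the number of repeated letters. -/
noncomputable def rep {m : ℕ} (w : Equiv.Perm (Fin m)) : ℕ :=
  len w - (supp w).ncard

/-- The value of `w` at the (0-based) position `i`, as a natural number. -/
def valAt {m : ℕ} (w : Equiv.Perm (Fin m)) (i : ℕ) : ℕ :=
  if h : i < m then (w ⟨i, h⟩ : ℕ) else 0

/-- The (0-based) position at which the value `v` occurs in `w`. -/
def posOf {m : ℕ} (w : Equiv.Perm (Fin m)) (v : ℕ) : ℕ :=
  if h : v < m then (w⁻¹ ⟨v, h⟩ : ℕ) else 0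

/-- `Mstat w k`: the maximum of the first `k + 1` entries of `w`. -/
noncomputable def Mstat {m : ℕ} (w : Equiv.Perm (Fin m)) (k : ℕ) : ℕ :=
  sSup {v | ∃ i : Fin m, (i : ℕ) ≤ k ∧ (w i : ℕ) = v}

/-- `mstat w k`: the minimum of the entries of `w` in positions `> k`. -/
noncomputable def mstat {m : ℕ} (w : Equiv.Perm (Fin m)) (k : ℕ) : ℕ :=
  sInf {v | ∃ i : Fin m, k < (i : ℕ) ∧ (w i : ℕ) = v}

/-- `wbar` is obtained from `w` by deleting the largest letter from the one-line
notation of `w` and sliding all subsequent letters one space to the left. -/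
def IsDeletion {n : ℕ} (w : Equiv.Perm (Fin (n + 1))) (wbar : Equiv.Perm (Fin n)) : Prop :=
  ∀ i : Fin n, (wbar i : ℕ) =
    if (i : ℕ) < posOf w n then valAt w (i : ℕ) else valAt w ((i : ℕ) + 1)

/-- `newrep w wbar`: the letters `k` with `s_k ∈ supp(wbar)` and `w⁻¹(top) ≤ k`. -/
noncomputable def newrep {n : ℕ} (w : Equiv.Perm (Fin (n + 1))) (wbar : Equiv.Perm (Fin n)) :
    Set ℕ :=
  {k | k ∈ supp wbar ∧ posOf w n ≤ k}

/-- An occurrence of the pattern `p` in `w`, recorded by its set `S` of values: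
there are positions `f 0 < f 1 < ⋯` whose values are in the same relative order
as `p`, and `S` is the corresponding set of values. -/
def IsOccSet {m c : ℕ} (p : Fin c → ℕ) (w : Equiv.Perm (Fin m)) (S : Finset ℕ) : Prop :=
  ∃ f : Fin c → Fin m, StrictMono f ∧ (∀ a b : Fin c, p a < p b ↔ w (f a) < w (f b)) ∧
    S = Finset.image (fun a => (w (f a) : ℕ)) Finset.univ

/-- An `N`-occurrence (here `N = n`, the largest 0-based value): an occurrence
whose largest letter is the largest value of `w`. -/
def IsTopOccSet {n c : ℕ} (p : Fin c → ℕ) (w : Equiv.Perm (Fin (n + 1))) (S : Finset ℕ) : Prop :=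
  IsOccSet p w S ∧ n ∈ S

/-- The number of occurrences of the pattern `p` in `w`. -/
noncomputable def occCount {m c : ℕ} (p : Fin c → ℕ) (w : Equiv.Perm (Fin m)) : ℕ :=
  Set.ncard {S : Finset ℕ | IsOccSet p w S}

/-- The number of `N`-occurrences of the pattern `p` in `w`. -/
noncomputable def topOccCount {n c : ℕ} (p : Fin c → ℕ) (w : Equiv.Perm (Fin (n + 1))) : ℕ :=
  Set.ncard {S : Finset ℕ | IsTopOccSet p w S}

def p321 : Fin 3 → ℕ := ![3, 2, 1]
def p3412 : Fin 4 → ℕ := ![3, 4, 1, 2]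
def p4321 : Fin 4 → ℕ := ![4, 3, 2, 1]
def p34512 : Fin 5 → ℕ := ![3, 4, 5, 1, 2]
def p45123 : Fin 5 → ℕ := ![4, 5, 1, 2, 3]
def p35412 : Fin 5 → ℕ := ![3, 5, 4, 1, 2]
def p43512 : Fin 5 → ℕ := ![4, 3, 5, 1, 2]
def p45132 : Fin 5 → ℕ := ![4, 5, 1, 3, 2]
def p45213 : Fin 5 → ℕ := ![4, 5, 2, 1, 3]
def p53412 : Fin 5 → ℕ := ![5, 3, 4, 1, 2]
def p45312 : Fin 5 → ℕ := ![4, 5, 3, 1, 2]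
def p45231 : Fin 5 → ℕ := ![4, 5, 2, 3, 1]

/-- The pattern `𝔭_k(w)` of Definition 4.4, recorded as its set of values:
(I) if `w⁻¹(top)` is left of `w⁻¹(M_k)`, the 321-occurrence `{top, M_k, m_k}`;
(II) else if `wbar(k) > m_k`, the 321-occurrence `{top, wbar(k), m_k}`;
(III) otherwise the 3412-occurrence `{M_k, top, wbar(k), m_k}`. -/
noncomputable def pocc {n : ℕ} (w : Equiv.Perm (Fin (n + 1))) (wbar : Equiv.Perm (Fin n))
    (k : ℕ) : Finset ℕ :=
  if posOf w n < posOf w (Mstat wbar k) then {n, Mstat wbar k, mstat wbar k}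
  else if mstat wbar k < valAt wbar k then {n, valAt wbar k, mstat wbar k}
  else {Mstat wbar k, n, valAt wbar k, mstat wbar k}

/-- Among the permutations with a given preimage of `{0, …, k}`, those keeping all entries `≤ k`
in increasing order and all entries `> k` in increasing order: the minimal length representatives
of the right cosets of the stabilizer of `{0, …, k}`. -/
def IsMinRep {n : ℕ} (k : ℕ) (x : Equiv.Perm (Fin n)) : Prop :=
  ∀ p q : Fin n, p < q → ((x p : ℕ) ≤ k ↔ (x q : ℕ) ≤ k) → x p < x q

theorem sr_of_lt {n i : ℕ} (h : i + 1 < n) :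
    sr n i = Equiv.swap ⟨i, Nat.lt_of_succ_lt h⟩ ⟨i + 1, h⟩ := dif_pos h

theorem val_sr_apply {n i : ℕ} (h : i + 1 < n) (p : Fin n) :
    (sr n i p : ℕ) = if (p : ℕ) = i then i + 1 else if (p : ℕ) = i + 1 then i else p := by
  rw [sr_of_lt h, Equiv.swap_apply_def]
  simp only [Fin.ext_iff]
  split_ifs <;> rfl

theorem isMinRep_one {n k : ℕ} : IsMinRep k (1 : Equiv.Perm (Fin n)) := fun _ _ h _ => h

theorem isMinRep_mul_sr {n k i : ℕ} {x : Equiv.Perm (Fin n)} (hx : IsMinRep k x) (h : i + 1 < n)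
    (hne : ¬((x ⟨i, Nat.lt_of_succ_lt h⟩ : ℕ) ≤ k ↔ (x ⟨i + 1, h⟩ : ℕ) ≤ k)) :
    IsMinRep k (x * sr n i) := by
  intro p q hpq hside
  refine hx _ _ ?_ hside
  rw [Fin.lt_def] at hpq ⊢
  by_cases hc : (p : ℕ) = i ∧ (q : ℕ) = i + 1
  · exfalso
    obtain ⟨hp, hq⟩ := hc
    have h1 : sr n i p = ⟨i + 1, h⟩ := by
      ext; rw [val_sr_apply h]; simp [hp]
    have h2 : sr n i q = ⟨i, Nat.lt_of_succ_lt h⟩ := by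
      ext; rw [val_sr_apply h]; simp [hq]
    simp only [Equiv.Perm.mul_apply, h1, h2] at hside
    exact hne hside.symm
  · rw [val_sr_apply h, val_sr_apply h]
    split_ifs <;> omega

theorem IsMinRep.mul_sr_eq {n k i : ℕ} {x : Equiv.Perm (Fin n)} (hx : IsMinRep k x)
    (h : i + 1 < n)
    (hside : (x ⟨i, Nat.lt_of_succ_lt h⟩ : ℕ) ≤ k ↔ (x ⟨i + 1, h⟩ : ℕ) ≤ k) :
    ∃ j, j + 1 < n ∧ j ≠ k ∧ x * sr n i = sr n j * x := by
  set a : Fin n := ⟨i, Nat.lt_of_succ_lt h⟩ with ha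
  set b : Fin n := ⟨i + 1, h⟩ with hb
  have hab : x a < x b := hx a b (by simp [ha, hb, Fin.lt_def]) hside
  rw [Fin.lt_def] at hab
  have hsucc : (x b : ℕ) = x a + 1 := by
    by_contra hne
    have hlt : (x a : ℕ) + 1 < n := by have := (x b).isLt; omega
    obtain ⟨p, hp⟩ := x.surjective ⟨x a + 1, hlt⟩
    have hpv : (x p : ℕ) = x a + 1 := by rw [hp]
    have hps : (x p : ℕ) ≤ k ↔ (x a : ℕ) ≤ k := by omega
    have h1 : ¬ p < a := fun hlt' => by
      have := hx p a hlt' hps; rw [Fin.lt_def] at this; omega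
    have h2 : ¬ b < p := fun hlt' => by
      have := hx b p hlt' (by omega); rw [Fin.lt_def] at this; omega
    have h3 : p ≠ a := fun he => by rw [he] at hpv; omega
    have h4 : p ≠ b := fun he => by rw [he] at hpv; omega
    simp only [Fin.lt_def, ne_eq, Fin.ext_iff, ha, hb] at h1 h2 h3 h4
    omega
  have hj : (x a : ℕ) + 1 < n := by have := (x b).isLt; omega
  refine ⟨x a, hj, by omega, ?_⟩
  have hxb : (⟨x a + 1, hj⟩ : Fin n) = x b := by ext; exact hsucc.symm
  rw [sr_of_lt h, sr_of_lt hj, hxb, Equiv.mul_swap_eq_swap_mul]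

theorem exists_word_mul_isMinRep {n k : ℕ} (l : List ℕ) (hl : ∀ i ∈ l, i + 1 < n) :
    ∃ (l' : List ℕ) (x : Equiv.Perm (Fin n)), (∀ j ∈ l', j + 1 < n ∧ j ≠ k) ∧ IsMinRep k x ∧
      (l.map (sr n)).prod = (l'.map (sr n)).prod * x ∧
      (l'.length < l.length ∨ l'.length = l.length ∧ x = 1 ∧ k ∉ l) := by
  induction l using List.reverseRecOn with
  | nil => exact ⟨[], 1, by simp, isMinRep_one, by simp, by simp⟩
  | append_singleton l i ih =>
    obtain ⟨l', x, hl', hx, hprod, hlen⟩ := ih fun j hj => hl j (by simp [hj])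
    have hi : i + 1 < n := hl i (by simp)
    by_cases hside : (x ⟨i, Nat.lt_of_succ_lt hi⟩ : ℕ) ≤ k ↔ (x ⟨i + 1, hi⟩ : ℕ) ≤ k
    · rcases hlen with hlen | ⟨hlen, rfl, hkl⟩
      · obtain ⟨j, hjn, hjk, hj⟩ := hx.mul_sr_eq hi hside
        refine ⟨l' ++ [j], x, ?_, hx, ?_, Or.inl (by simpa using hlen)⟩
        · intro t ht
          rcases List.mem_append.1 ht with ht | ht
          · exact hl' t ht
          · rw [List.mem_singleton.1 ht]
            exact ⟨hjn, hjk⟩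
        · simp [hprod, mul_assoc, hj]
      · have hik : i ≠ k := by
          simp only [Equiv.Perm.one_apply] at hside
          omega
        refine ⟨l' ++ [i], 1, ?_, hx, by simp [hprod], Or.inr ⟨by simpa using hlen, rfl, ?_⟩⟩
        · intro t ht
          rcases List.mem_append.1 ht with ht | ht
          · exact hl' t ht
          · rw [List.mem_singleton.1 ht]
            exact ⟨hi, hik⟩
        · simp [hkl, hik.symm]
    · refine ⟨l', x * sr n i, hl', isMinRep_mul_sr hx hi hside, by simp [hprod, mul_assoc],
        Or.inl ?_⟩
      simp only [List.length_append, List.length_singleton]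
      omega

theorem prod_map_sr_apply_le_iff {n k : ℕ} (l : List ℕ) (hl : ∀ j ∈ l, j + 1 < n ∧ j ≠ k)
    (p : Fin n) : ((l.map (sr n)).prod p : ℕ) ≤ k ↔ (p : ℕ) ≤ k := by
  induction l with
  | nil => simp
  | cons j l ih =>
    obtain ⟨hj, hjk⟩ := hl j (by simp)
    rw [List.map_cons, List.prod_cons, Equiv.Perm.mul_apply, val_sr_apply hj,
      ← ih fun t ht => hl t (by simp [ht])]
    split_ifs <;> omega

theorem IsMinRep.eq_one {n k : ℕ} {x : Equiv.Perm (Fin n)} (hx : IsMinRep k x)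
    (h : ∀ p, (x p : ℕ) ≤ k ↔ (p : ℕ) ≤ k) : x = 1 := by
  have hmono : StrictMono x := by
    intro p q hpq
    by_cases hs : (x p : ℕ) ≤ k ↔ (x q : ℕ) ≤ k
    · exact hx p q hpq hs
    · have h1 := h p
      have h2 := h q
      rw [Fin.lt_def] at hpq ⊢
      omega
  have hiso : hmono.orderIsoOfSurjective x x.surjective = OrderIso.refl (Fin n) :=
    Subsingleton.elim _ _
  ext p
  exact congrArg Fin.val (DFunLike.congr_fun hiso p)

/-- A permutation whose support contains `s_k` does not stabilize `{0, …, k}`. -/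
theorem exists_not_apply_le_iff_of_mem_supp {n k : ℕ} {u : Equiv.Perm (Fin n)} (hk : k ∈ supp u) :
    ∃ p, ¬((u p : ℕ) ≤ k ↔ (p : ℕ) ≤ k) := by
  by_contra! hstab
  obtain ⟨l, ⟨⟨hl, hprod⟩, hlen⟩, hkl⟩ := hk
  obtain ⟨l', x, hl', hx, hprod', hlen'⟩ := exists_word_mul_isMinRep (k := k) l hl
  have hx1 : x = 1 := hx.eq_one fun p => by
    rw [← prod_map_sr_apply_le_iff l' hl', ← Equiv.Perm.mul_apply, ← hprod', hprod, hstab]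
  have hlt : l'.length < l.length := hlen'.resolve_right fun h => h.2.2 hkl
  have hle : len u ≤ l'.length :=
    Nat.sInf_le ⟨l', ⟨fun j hj => (hl' j hj).1, by rw [← hprod, hprod', hx1, mul_one]⟩, rfl⟩
  omega

theorem lt_of_mem_supp {n k : ℕ} {u : Equiv.Perm (Fin n)} (hk : k ∈ supp u) : k + 1 < n := by
  obtain ⟨l, ⟨⟨hl, -⟩, -⟩, hkl⟩ := hk
  exact hl k hkl

theorem apply_le_Mstat {n k : ℕ} (u : Equiv.Perm (Fin n)) (i : Fin n) (hi : (i : ℕ) ≤ k) :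
    (u i : ℕ) ≤ Mstat u k :=
  le_csSup ⟨n, by rintro _ ⟨j, -, rfl⟩; exact (u j).isLt.le⟩ ⟨i, hi, rfl⟩

theorem exists_apply_eq_Mstat {n k : ℕ} (u : Equiv.Perm (Fin n)) (hk : k < n) :
    ∃ i : Fin n, (i : ℕ) ≤ k ∧ (u i : ℕ) = Mstat u k :=
  Nat.sSup_mem (s := {v | ∃ i : Fin n, (i : ℕ) ≤ k ∧ (u i : ℕ) = v}) ⟨_, ⟨k, hk⟩, le_rfl, rfl⟩
    ⟨n, by rintro _ ⟨j, -, rfl⟩; exact (u j).isLt.le⟩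

theorem mstat_le_apply {n k : ℕ} (u : Equiv.Perm (Fin n)) (i : Fin n) (hi : k < (i : ℕ)) :
    mstat u k ≤ u i :=
  Nat.sInf_le ⟨i, hi, rfl⟩

theorem exists_apply_eq_mstat {n k : ℕ} (u : Equiv.Perm (Fin n)) (hk : k + 1 < n) :
    ∃ i : Fin n, k < (i : ℕ) ∧ (u i : ℕ) = mstat u k :=
  Nat.sInf_mem (s := {v | ∃ i : Fin n, k < (i : ℕ) ∧ (u i : ℕ) = v})
    ⟨_, ⟨k + 1, hk⟩, Nat.lt_succ_self k, rfl⟩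

theorem exists_le_lt_apply {n k : ℕ} (u : Equiv.Perm (Fin n))
    (h : ∃ p : Fin n, (p : ℕ) ≤ k ∧ k < (u p : ℕ)) : ∃ q : Fin n, k < (q : ℕ) ∧ (u q : ℕ) ≤ k := by
  by_contra! hcon
  obtain ⟨p, hp, hup⟩ := h
  have hmaps : ∀ q ∈ insert p (Finset.univ.filter fun q : Fin n => k < (q : ℕ)),
      u q ∈ Finset.univ.filter fun q : Fin n => k < (q : ℕ) := by
    intro q hq
    simp only [Finset.mem_insert, Finset.mem_filter, Finset.mem_univ, true_and] at hq ⊢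
    rcases hq with rfl | hq
    · exact hup
    · exact hcon q hq
  have hcard := Finset.card_le_card_of_injOn u hmaps u.injective.injOn
  rw [Finset.card_insert_of_notMem (by simp [hp])] at hcard
  omega

theorem exists_lt_apply_le {n k : ℕ} (u : Equiv.Perm (Fin n))
    (h : ∃ q : Fin n, k < (q : ℕ) ∧ (u q : ℕ) ≤ k) : ∃ p : Fin n, (p : ℕ) ≤ k ∧ k < (u p : ℕ) := by
  obtain ⟨q, hq, huq⟩ := h
  obtain ⟨r, hr, hur⟩ := exists_le_lt_apply u⁻¹ ⟨u q, huq, by simpa using hq⟩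
  exact ⟨u⁻¹ r, hur, by simpa using hr⟩

theorem mstat_lt_Mstat_of_mem_supp {n k : ℕ} {u : Equiv.Perm (Fin n)} (hk : k ∈ supp u) :
    mstat u k < Mstat u k := by
  obtain ⟨r, hr⟩ := exists_not_apply_le_iff_of_mem_supp hk
  have hp : ∃ p : Fin n, (p : ℕ) ≤ k ∧ k < (u p : ℕ) := by
    by_cases h : (r : ℕ) ≤ k
    · exact ⟨r, h, by omega⟩
    · exact exists_lt_apply_le u ⟨r, by omega, by omega⟩
  obtain ⟨q, hq, huq⟩ := exists_le_lt_apply u hp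
  obtain ⟨p, hp, hup⟩ := hp
  have := apply_le_Mstat u p hp
  have := mstat_le_apply u q hq
  omega

theorem posOf_apply {m : ℕ} (w : Equiv.Perm (Fin m)) (i : Fin m) : posOf w (w i) = i := by
  simp [posOf]

theorem IsDeletion.apply_eq {n : ℕ} {w : Equiv.Perm (Fin (n + 1))} {wbar : Equiv.Perm (Fin n)}
    (hdel : IsDeletion w wbar) (i : Fin n) :
    ((i : ℕ) < posOf w n → (w i.castSucc : ℕ) = wbar i) ∧
      (posOf w n ≤ i → (w i.succ : ℕ) = wbar i) := by
  have h := hdel i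
  have hi := i.isLt
  constructor
  · intro hlt
    rw [if_pos hlt, valAt, dif_pos (by omega)] at h
    exact h.symm
  · intro hle
    rw [if_neg (by omega), valAt, dif_pos (by omega)] at h
    exact h.symm

theorem IsDeletion.posOf_lt_posOf_iff {n : ℕ} {w : Equiv.Perm (Fin (n + 1))}
    {wbar : Equiv.Perm (Fin n)} (hdel : IsDeletion w wbar) (i : Fin n) :
    posOf w n < posOf w (wbar i) ↔ posOf w n ≤ i := by
  rcases lt_or_ge (i : ℕ) (posOf w n) with h | h
  · rw [← (hdel.apply_eq i).1 h, posOf_apply, Fin.val_castSucc]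
    omega
  · rw [← (hdel.apply_eq i).2 h, posOf_apply, Fin.val_succ]
    omega

theorem IsDeletion.exists_isTopOccSet_p4321 {n : ℕ} {w : Equiv.Perm (Fin (n + 1))}
    {wbar : Equiv.Perm (Fin n)} (hdel : IsDeletion w wbar) {a b c : Fin n}
    (ha : posOf w n ≤ a) (hab : a < b) (hbc : b < c) (hba : wbar b < wbar a)
    (hcb : wbar c < wbar b) : ∃ S : Finset ℕ, IsTopOccSet p4321 w S := by
  rw [Fin.lt_def] at hab hbc hba hcb
  have hwa := (hdel.apply_eq a).2 ha
  have hwb := (hdel.apply_eq b).2 (by omega)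
  have hwc := (hdel.apply_eq c).2 (by omega)
  have hP : posOf w n = (w⁻¹ (Fin.last n) : ℕ) := by
    rw [posOf, dif_pos (Nat.lt_succ_self n)]; rfl
  have hwP : w (w⁻¹ (Fin.last n)) = Fin.last n := by simp
  generalize w⁻¹ (Fin.last n) = z at hP hwP
  have hwan : (wbar a : ℕ) < n := (wbar a).isLt
  refine ⟨_, ⟨![z, a.succ, b.succ, c.succ], ?_, ?_, rfl⟩, ?_⟩
  · rw [Fin.strictMono_iff_lt_succ]
    intro i
    rw [Fin.lt_def]
    fin_cases i <;> simp <;> omega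
  · intro i j
    rw [Fin.lt_def]
    fin_cases i <;> fin_cases j <;> simp [p4321, hwP, hwa, hwb, hwc] <;> omega
  · exact Finset.mem_image.2 ⟨0, Finset.mem_univ _, by simp [hwP]⟩

theorem eq_and_eq_of_insert_pair_eq {n a b c d : ℕ} (hb : b < a) (hd : d < c) (hc : c < n)
    (h : ({n, a, b} : Finset ℕ) = {n, c, d}) : a = c ∧ b = d := by
  simp only [Finset.ext_iff, Finset.mem_insert, Finset.mem_singleton] at h
  have := h a
  have := h b
  have := h c
  have := h d
  omega

theorem insert_triple_ne {n a b c x y : ℕ} (hc : c < b) (hb : b < a) (ha : a < n) :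
    ({a, n, c, b} : Finset ℕ) ≠ {n, x, y} := by
  intro h
  simp only [Finset.ext_iff, Finset.mem_insert, Finset.mem_singleton] at h
  have := h a
  have := h b
  have := h c
  omega

theorem insert_triple_eq {n a b c x y z : ℕ} (hc : c < b) (hb : b < a) (ha : a < n)
    (hz : z < y) (hy : y < x) (hx : x < n)
    (h : ({a, n, c, b} : Finset ℕ) = {x, n, z, y}) : c = z := by
  simp only [Finset.ext_iff, Finset.mem_insert, Finset.mem_singleton] at h
  have := h c
  have := h z
  omega

theorem exists_isTopOccSet_p4321_of_pocc_eq_of_lt {n : ℕ} {w : Equiv.Perm (Fin (n + 1))}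
    {wbar : Equiv.Perm (Fin n)} (hdel : IsDeletion w wbar) {k k' : ℕ} (hk : k ∈ newrep w wbar)
    (hk' : k' ∈ newrep w wbar) (hlt : k < k') (heq : pocc w wbar k = pocc w wbar k') :
    ∃ S : Finset ℕ, IsTopOccSet p4321 w S := by
  obtain ⟨hks, hkP⟩ := hk
  obtain ⟨hks', hkP'⟩ := hk'
  have hkn := lt_of_mem_supp hks
  have hkn' := lt_of_mem_supp hks'
  have hmM := mstat_lt_Mstat_of_mem_supp hks
  have hmM' := mstat_lt_Mstat_of_mem_supp hks'
  obtain ⟨i, hi, hiM⟩ := exists_apply_eq_Mstat wbar (Nat.lt_of_succ_lt hkn)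
  obtain ⟨i', hi', hiM'⟩ := exists_apply_eq_Mstat wbar (Nat.lt_of_succ_lt hkn')
  obtain ⟨j, hj, hjm⟩ := exists_apply_eq_mstat wbar hkn
  obtain ⟨j', hj', hjm'⟩ := exists_apply_eq_mstat wbar hkn'
  obtain ⟨K, rfl⟩ : ∃ K : Fin n, (K : ℕ) = k := ⟨⟨k, by omega⟩, rfl⟩
  obtain ⟨K', rfl⟩ : ∃ K : Fin n, (K : ℕ) = k' := ⟨⟨k', by omega⟩, rfl⟩
  have hval (p : Fin n) : valAt wbar p = wbar p := by simp [valAt]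
  have hinj (p q : Fin n) (h : (wbar p : ℕ) = wbar q) : (p : ℕ) = q :=
    congrArg Fin.val (wbar.injective (Fin.ext h))
  have hKM := apply_le_Mstat wbar K le_rfl
  have hiM2 := apply_le_Mstat wbar i (hi.trans hlt.le)
  have hKM' := apply_le_Mstat wbar K' le_rfl
  have hKm := mstat_le_apply wbar K' hlt
  have hbound (p : Fin n) : (wbar p : ℕ) < n := (wbar p).isLt
  have hni := hbound i
  have hni' := hbound i'
  have hnK' := hbound K'
  have hjK := hinj j K
  have hjK' := hinj j' K'
  simp only [pocc, hval, ← hiM, ← hiM', hdel.posOf_lt_posOf_iff] at heq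
  split_ifs at heq with h1
  · obtain ⟨hM, hm⟩ := eq_and_eq_of_insert_pair_eq (by omega) (by omega) hni' heq
    have hne := hinj K' i
    refine hdel.exists_isTopOccSet_p4321 (a := i) (b := K') (c := j') h1 ?_ hj' ?_ ?_ <;>
      rw [Fin.lt_def] <;> omega
  · obtain ⟨hM, hm⟩ := eq_and_eq_of_insert_pair_eq (by omega) (by omega) hnK' heq
    have := hinj _ _ hM
    omega
  · exact absurd heq.symm (insert_triple_ne (by omega) (by omega) hni')
  · obtain ⟨hM, hm⟩ := eq_and_eq_of_insert_pair_eq (by omega) (by omega) hni' heq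
    have := hinj K i (by omega)
    omega
  · obtain ⟨hM, hm⟩ := eq_and_eq_of_insert_pair_eq (by omega) (by omega) hnK' heq
    have := hinj _ _ hM
    omega
  · exact absurd heq.symm (insert_triple_ne (by omega) (by omega) hni')
  · exact absurd heq (insert_triple_ne (by omega) (by omega) hni)
  · exact absurd heq (insert_triple_ne (by omega) (by omega) hni)
  · have := hinj K K' (insert_triple_eq (by omega) (by omega) hni (by omega) (by omega) hni' heq)
    omega

/-- if two distinct elements of `newrep(w)` give the same pattern
`𝔭_k(w)`, then `w` has an `N`-occurrence of 4321. -/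
theorem overcount_implies_4321 {n : ℕ} (w : Equiv.Perm (Fin (n + 1)))
    (wbar : Equiv.Perm (Fin n)) (hdel : IsDeletion w wbar) (k k' : ℕ)
    (hk : k ∈ newrep w wbar) (hk' : k' ∈ newrep w wbar) (hne : k ≠ k')
    (heq : pocc w wbar k = pocc w wbar k') :
    ∃ S : Finset ℕ, IsTopOccSet p4321 w S := by
  rcases lt_or_gt_of_ne hne with h | h
  · exact exists_isTopOccSet_p4321_of_pocc_eq_of_lt hdel hk hk' h heq
  · exact exists_isTopOccSet_p4321_of_pocc_eq_of_lt hdel hk' hk h heq.symm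
end

section
/- Let w ∈ S_N. If w has an N-occurrence of the pattern 4321, then |newrep(w)| < [321;3412]_N(w). -/
/-- The inversions of `u`, as pairs of positions. -/
def invPairs {m : ℕ} (u : Equiv.Perm (Fin m)) : Finset (Fin m × Fin m) :=
  Finset.univ.filter fun q => q.1 < q.2 ∧ u q.2 < u q.1

theorem mem_invPairs {m : ℕ} (u : Equiv.Perm (Fin m)) (a b : Fin m) :
    (a, b) ∈ invPairs u ↔ a < b ∧ u b < u a := by
  simp [invPairs]

theorem sr_apply_val {m i : ℕ} (h : i + 1 < m) (x : Fin m) :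
    (sr m i x : ℕ) = if (x : ℕ) = i then i + 1 else if (x : ℕ) = i + 1 then i else x := by
  rw [sr, dif_pos h, Equiv.swap_apply_def]
  simp only [Fin.ext_iff]
  split_ifs <;> rfl

theorem sr_mul_self (m i : ℕ) : sr m i * sr m i = 1 := by
  unfold sr
  split_ifs <;> simp

theorem invPairs_sr_mul {m i : ℕ} (h : i + 1 < m) (u : Equiv.Perm (Fin m)) {A B : Fin m}
    (hA : (u A : ℕ) = i) (hB : (u B : ℕ) = i + 1) (hAB : A < B) :
    invPairs (sr m i * u) = insert (A, B) (invPairs u) := by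
  ext ⟨a, b⟩
  have inj : ∀ x y : Fin m, (u x : ℕ) = u y → x = y := fun x y hxy =>
    u.injective (Fin.ext hxy)
  rw [Finset.mem_insert, mem_invPairs, mem_invPairs, Prod.mk.injEq]
  simp only [Equiv.Perm.mul_apply, Fin.lt_def, sr_apply_val h]
  have h1 := inj a A
  have h2 := inj a B
  have h3 := inj b A
  have h4 := inj b B
  have h5 := inj a b
  rw [Fin.lt_def] at hAB
  grind

theorem card_invPairs_sr_mul {m i : ℕ} (h : i + 1 < m) (u : Equiv.Perm (Fin m)) {A B : Fin m}
    (hA : (u A : ℕ) = i) (hB : (u B : ℕ) = i + 1) (hAB : A < B) :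
    (invPairs (sr m i * u)).card = (invPairs u).card + 1 := by
  rw [invPairs_sr_mul h u hA hB hAB, Finset.card_insert_of_notMem]
  rw [mem_invPairs, Fin.lt_def, Fin.lt_def]
  omega

theorem card_invPairs_sr_mul_of_gt {m i : ℕ} (h : i + 1 < m) (u : Equiv.Perm (Fin m))
    {A B : Fin m} (hA : (u A : ℕ) = i) (hB : (u B : ℕ) = i + 1) (hBA : B < A) :
    (invPairs u).card = (invPairs (sr m i * u)).card + 1 := by
  have := card_invPairs_sr_mul h (sr m i * u) (A := B) (B := A)
    (by simp [sr_apply_val h, hB]) (by simp [sr_apply_val h, hA]) hBA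
  rwa [← mul_assoc, sr_mul_self, one_mul] at this

theorem exists_word_length_le {m : ℕ} (u : Equiv.Perm (Fin m)) :
    ∃ l, IsWord m l u ∧ l.length ≤ (invPairs u).card := by
  induction hc : (invPairs u).card using Nat.strong_induction_on generalizing u with
  | _ c ih =>
    by_cases hd : ∃ (i : ℕ) (h : i + 1 < m),
        u⁻¹ ⟨i + 1, h⟩ < u⁻¹ ⟨i, Nat.lt_of_succ_lt h⟩
    · obtain ⟨i, h, hlt⟩ := hd
      have hcard := card_invPairs_sr_mul_of_gt h u (by simp) (by simp) hlt
      obtain ⟨l, ⟨hl, hprod⟩, hlen⟩ := ih _ (by omega) (sr m i * u) rfl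
      refine ⟨i :: l, ⟨?_, ?_⟩, ?_⟩
      · simpa [h] using hl
      · rw [List.map_cons, List.prod_cons, hprod, ← mul_assoc, sr_mul_self, one_mul]
      · rw [List.length_cons]; omega
    · push Not at hd
      have hmono : StrictMono (u⁻¹ : Equiv.Perm (Fin m)) := by
        cases m with
        | zero => exact fun a => a.elim0
        | succ m =>
          refine Fin.strictMono_iff_lt_succ.2 fun i => lt_of_le_of_ne ?_ ?_
          · exact hd i (by omega)
          · exact fun he => (Fin.castSucc_lt_succ (i := i)).ne (u⁻¹.injective he)
      have hid : u⁻¹ = 1 := by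
        ext x
        have := Subsingleton.elim (hmono.orderIsoOfSurjective _ u⁻¹.surjective)
          (OrderIso.refl (Fin m))
        exact congrArg Fin.val (DFunLike.congr_fun this x)
      exact ⟨[], ⟨by simp, by simpa using (inv_eq_one.1 hid).symm⟩, Nat.zero_le _⟩

theorem card_invPairs_prod_le {m : ℕ} {l : List ℕ} (hl : ∀ i ∈ l, i + 1 < m) :
    (invPairs (l.map (sr m)).prod).card ≤ l.length := by
  induction l with
  | nil =>
    simp only [List.map_nil, List.prod_nil, List.length_nil, nonpos_iff_eq_zero,
      Finset.card_eq_zero]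
    ext ⟨a, b⟩
    simp only [mem_invPairs, Equiv.Perm.one_apply, Finset.notMem_empty, iff_false]
    exact fun hab => lt_asymm hab.1 hab.2
  | cons i l ih =>
    have h := hl i (by simp)
    have := ih fun j hj => hl j (by simp [hj])
    rw [List.map_cons, List.prod_cons, List.length_cons]
    set u := (l.map (sr m)).prod
    rcases lt_trichotomy (u⁻¹ ⟨i, Nat.lt_of_succ_lt h⟩) (u⁻¹ ⟨i + 1, h⟩) with hlt | he | hgt
    · have := card_invPairs_sr_mul h u (by simp) (by simp) hlt
      omega
    · simp at he
    · have := card_invPairs_sr_mul_of_gt h u (by simp) (by simp) hgt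
      omega

theorem prod_apply_le_iff {m k : ℕ} {l : List ℕ} (hl : ∀ i ∈ l, i + 1 < m) (hk : k ∉ l)
    (x : Fin m) : ((l.map (sr m)).prod x : ℕ) ≤ k ↔ (x : ℕ) ≤ k := by
  induction l with
  | nil => simp
  | cons i l ih =>
    rw [← ih (fun j hj => hl j (by simp [hj])) (fun h => hk (by simp [h])), List.map_cons,
      List.prod_cons, Equiv.Perm.mul_apply, sr_apply_val (hl i (by simp))]
    have : k ≠ i := fun h => hk (by simp [h])
    split_ifs <;> omega

theorem exists_invPairs_of_mem_word {m k : ℕ} {l : List ℕ} (hl : ∀ i ∈ l, i + 1 < m)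
    (hlen : l.length ≤ (invPairs (l.map (sr m)).prod).card) (hk : k ∈ l) :
    ∃ a b, (a, b) ∈ invPairs (l.map (sr m)).prod ∧ (a : ℕ) ≤ k ∧ k < (b : ℕ) := by
  induction l with
  | nil => simp at hk
  | cons i l ih =>
    have h := hl i (by simp)
    have hl' : ∀ j ∈ l, j + 1 < m := fun j hj => hl j (by simp [hj])
    have hle := card_invPairs_prod_le hl'
    have hpres := prod_apply_le_iff (k := k) hl'
    specialize ih hl'
    rw [List.map_cons, List.prod_cons] at hlen ⊢
    rw [List.length_cons] at hlen
    set u := (l.map (sr m)).prod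
    rcases lt_trichotomy (u⁻¹ ⟨i, Nat.lt_of_succ_lt h⟩) (u⁻¹ ⟨i + 1, h⟩) with hlt | he | hgt
    · have hcard := card_invPairs_sr_mul h u (by simp) (by simp) hlt
      rw [invPairs_sr_mul h u (by simp) (by simp) hlt]
      by_cases hkl : k ∈ l
      · obtain ⟨a, b, hab, hak, hkb⟩ := ih (by omega) hkl
        exact ⟨a, b, Finset.mem_insert_of_mem hab, hak, hkb⟩
      · obtain rfl : k = i := by simpa [hkl] using hk
        refine ⟨_, _, Finset.mem_insert_self _ _, ?_, ?_⟩
        · rw [← hpres hkl]; simp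
        · rw [← not_le, ← hpres hkl]; simp
    · simp at he
    · have := card_invPairs_sr_mul_of_gt h u (by simp) (by simp) hgt
      omega

/-- Every cut indexed by a letter in the support of `u` is crossed by an inversion of `u`. -/
theorem exists_inversion_of_mem_supp {m k : ℕ} {u : Equiv.Perm (Fin m)} (hk : k ∈ supp u) :
    ∃ a b : Fin m, (a : ℕ) ≤ k ∧ k < (b : ℕ) ∧ u b < u a := by
  obtain ⟨l, ⟨⟨hl, rfl⟩, hlen⟩, hkl⟩ := hk
  obtain ⟨l', hl', hle⟩ := exists_word_length_le (l.map (sr m)).prod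
  have hmin : len (l.map (sr m)).prod ≤ l'.length := Nat.sInf_le ⟨l', hl', rfl⟩
  obtain ⟨a, b, hab, hak, hkb⟩ := exists_invPairs_of_mem_word hl (by omega) hkl
  exact ⟨a, b, hak, hkb, ((mem_invPairs _ _ _).1 hab).2⟩

theorem finite_topOccSet {n c : ℕ} (p : Fin c → ℕ) (w : Equiv.Perm (Fin (n + 1))) :
    {S : Finset ℕ | IsTopOccSet p w S}.Finite := by
  refine (Finset.range (n + 1)).powerset.finite_toSet.subset ?_
  rintro S ⟨⟨f, -, -, rfl⟩, -⟩
  rw [Finset.mem_coe, Finset.mem_powerset]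
  intro v hv
  obtain ⟨a, -, rfl⟩ := Finset.mem_image.1 hv
  exact Finset.mem_range.2 (w (f a)).isLt

theorem posOf_top {n : ℕ} (w : Equiv.Perm (Fin (n + 1))) :
    posOf w n = (w⁻¹ (Fin.last n) : Fin (n + 1)) := by
  simp [posOf, Fin.last]

theorem IsDeletion.apply_of_le {n : ℕ} {w : Equiv.Perm (Fin (n + 1))} {wbar : Equiv.Perm (Fin n)}
    (hdel : IsDeletion w wbar) {i : Fin n} (hi : posOf w n ≤ i) :
    (w i.succ : ℕ) = wbar i := by
  rw [hdel i, if_neg (by omega), valAt, dif_pos (by omega)]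
  rfl

theorem IsDeletion.apply_of_lt {n : ℕ} {w : Equiv.Perm (Fin (n + 1))} {wbar : Equiv.Perm (Fin n)}
    (hdel : IsDeletion w wbar) {i : Fin n} (hi : (i : ℕ) < posOf w n) :
    (w i.castSucc : ℕ) = wbar i := by
  rw [hdel i, if_pos hi, valAt, dif_pos (by omega)]
  rfl

theorem IsDeletion.isTopOccSet_p321 {n : ℕ} {w : Equiv.Perm (Fin (n + 1))}
    {wbar : Equiv.Perm (Fin n)} (hdel : IsDeletion w wbar) {i j : Fin n}
    (hi : posOf w n ≤ i) (hij : i < j) (hlt : wbar j < wbar i) :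
    IsTopOccSet p321 w {n, (wbar i : ℕ), (wbar j : ℕ)} := by
  have hwi := hdel.apply_of_le hi
  have hwj := hdel.apply_of_le (i := j) (by omega)
  obtain ⟨t, ht, hp⟩ : ∃ t, w t = Fin.last n ∧ posOf w n = t := ⟨_, by simp, posOf_top w⟩
  refine ⟨⟨![t, i.succ, j.succ], ?_, ?_, ?_⟩, by simp⟩
  · rw [Fin.strictMono_iff_lt_succ]
    intro a
    fin_cases a <;> simp [Fin.lt_def, -Fin.val_fin_lt] <;> omega
  · intro a b
    have := (wbar i).isLt
    rw [Fin.lt_def] at hlt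
    fin_cases a <;> fin_cases b <;> simp [p321, Fin.lt_def, -Fin.val_fin_lt, ht, hwi, hwj] <;> omega
  · ext v
    simp [Fin.exists_fin_succ, ht, hwi, hwj, eq_comm]

theorem IsDeletion.isTopOccSet_p3412 {n : ℕ} {w : Equiv.Perm (Fin (n + 1))}
    {wbar : Equiv.Perm (Fin n)} (hdel : IsDeletion w wbar) {h i j : Fin n}
    (hh : (h : ℕ) < posOf w n) (hi : posOf w n ≤ i) (hij : i < j)
    (hlt : wbar i < wbar j) (hlt' : wbar j < wbar h) :
    IsTopOccSet p3412 w {(wbar h : ℕ), n, (wbar i : ℕ), (wbar j : ℕ)} := by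
  have hwh := hdel.apply_of_lt hh
  have hwi := hdel.apply_of_le hi
  have hwj := hdel.apply_of_le (i := j) (by omega)
  obtain ⟨t, ht, hp⟩ : ∃ t, w t = Fin.last n ∧ posOf w n = t := ⟨_, by simp, posOf_top w⟩
  refine ⟨⟨![h.castSucc, t, i.succ, j.succ], ?_, ?_, ?_⟩, by simp⟩
  · rw [Fin.strictMono_iff_lt_succ]
    intro a
    fin_cases a <;> simp [Fin.lt_def, -Fin.val_fin_lt] <;> omega
  · intro a b
    have := (wbar h).isLt
    rw [Fin.lt_def] at hlt hlt'
    fin_cases a <;> fin_cases b <;> simp [p3412, Fin.lt_def, -Fin.val_fin_lt, hwh, ht, hwi, hwj] <;> omega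
  · ext v
    simp [Fin.exists_fin_succ, hwh, ht, hwi, hwj, eq_comm]

theorem IsDeletion.exists_decreasing {n : ℕ} {w : Equiv.Perm (Fin (n + 1))}
    {wbar : Equiv.Perm (Fin n)} (hdel : IsDeletion w wbar)
    (h : ∃ S : Finset ℕ, IsTopOccSet p4321 w S) :
    ∃ i j l : Fin n, posOf w n ≤ i ∧ i < j ∧ j < l ∧ wbar j < wbar i ∧ wbar l < wbar j := by
  obtain ⟨S, ⟨f, hf, hord, rfl⟩, htop⟩ := h
  have h01 := hf (show (0 : Fin 4) < 1 by decide)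
  have h12 := hf (show (1 : Fin 4) < 2 by decide)
  have h23 := hf (show (2 : Fin 4) < 3 by decide)
  have hpos : posOf w n = f 0 := by
    obtain ⟨a, -, ha⟩ := Finset.mem_image.1 htop
    have hlast : w (f a) = Fin.last n := Fin.ext ha
    obtain rfl : a = 0 := by
      by_contra hne
      have h0 := (hord a 0).1 (by fin_cases a <;> simp_all [p4321])
      rw [hlast] at h0
      exact absurd h0 (Fin.le_last _).not_gt
    rw [posOf_top, ← hlast]
    simp
  have key : ∀ a, f 0 < f a → ∃ i : Fin n, f a = i.succ := fun a ha =>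
    (Fin.eq_succ_of_ne_zero (Fin.ne_zero_of_lt ha))
  obtain ⟨i, hi⟩ := key 1 h01
  obtain ⟨j, hj⟩ := key 2 (h01.trans h12)
  obtain ⟨l, hl⟩ := key 3 (h01.trans (h12.trans h23))
  have o1 := (hord 2 1).1 (by decide)
  have o2 := (hord 3 2).1 (by decide)
  rw [hi, hj] at h12
  rw [hj, hl] at h23
  rw [hi] at h01
  rw [hj, hi] at o1
  rw [hl, hj] at o2
  rw [Fin.succ_lt_succ_iff] at h12 h23
  rw [Fin.lt_def, Fin.val_succ] at h01
  rw [Fin.lt_def, hdel.apply_of_le (by omega), hdel.apply_of_le (by omega)] at o1 o2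
  exact ⟨i, j, l, by omega, h12, h23, o1, o2⟩

/-- The relation between a letter `k` of `newrep w wbar` and a top occurrence charged to it. -/
def IsCharged {n : ℕ} (wbar : Equiv.Perm (Fin n)) (k : Fin n) (T : Finset ℕ) : Prop :=
  (∃ j, k < j ∧ wbar j < wbar k ∧ (∀ l, j < l → wbar k < wbar l) ∧
    T = {n, (wbar k : ℕ), (wbar j : ℕ)}) ∨
  (∃ i j, i < k ∧ k < j ∧ wbar j < wbar i ∧ (∀ l, k < l → wbar k < wbar l) ∧
    T = {n, (wbar i : ℕ), (wbar k : ℕ)}) ∨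
  (∃ i j, k < j ∧ wbar k < wbar j ∧ wbar j < wbar i ∧
    T = {(wbar i : ℕ), n, (wbar k : ℕ), (wbar j : ℕ)})

theorem triple_eq {n x y x' y' : ℕ} (hy : y < x) (hx' : x' < n) (hy' : y' < x')
    (h : ({n, x, y} : Finset ℕ) = {n, x', y'}) : x = x' ∧ y = y' := by
  simp only [Finset.ext_iff, Finset.mem_insert, Finset.mem_singleton] at h
  have h1 := h x
  have h2 := h y
  have h3 := h x'
  have h4 := h y'
  omega

theorem quadruple_min_eq {n x y z x' y' z' : ℕ} (hz : z < n) (hy : y < z) (hx : x < y)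
    (hz' : z' < n) (hy' : y' < z') (hx' : x' < y')
    (h : ({z, n, x, y} : Finset ℕ) = {z', n, x', y'}) : x = x' := by
  simp only [Finset.ext_iff, Finset.mem_insert, Finset.mem_singleton] at h
  have h1 := h x
  have h2 := h x'
  omega

theorem triple_ne_quadruple {n x y x' y' z' : ℕ} (hx : x < n) (hy : y < x)
    (hz' : z' < n) (hy' : y' < z') (hx' : x' < y') :
    ({n, x, y} : Finset ℕ) ≠ {z', n, x', y'} := by
  intro h
  simp only [Finset.ext_iff, Finset.mem_insert, Finset.mem_singleton] at h
  have h1 := h x'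
  have h2 := h y'
  have h3 := h z'
  omega

theorem IsCharged.unique {n : ℕ} {wbar : Equiv.Perm (Fin n)} {k k' : Fin n} {T : Finset ℕ}
    (h : IsCharged wbar k T) (h' : IsCharged wbar k' T) : k = k' := by
  have inj : ∀ a b : Fin n, (wbar a : ℕ) = wbar b → a = b := fun a b hab =>
    wbar.injective (Fin.ext hab)
  have lt : ∀ a, (wbar a : ℕ) < n := fun a => (wbar a).isLt
  have aux : ∀ {k k' i j : Fin n}, k < j → wbar j < wbar k →
      (∀ l, j < l → wbar k < wbar l) → k' < i → wbar i < wbar k → k' ≠ j := by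
    rintro k k' i j - - hlast hi hlt rfl
    exact lt_asymm hlt (hlast i hi)
  rcases h with ⟨j, hkj, hlt, hlast, rfl⟩ | ⟨i, j, hik, hkj, hlt, hmin, rfl⟩ |
      ⟨i, j, hkj, hlt, hlt2, rfl⟩ <;>
    rcases h' with ⟨j', hkj', hlt', hlast', hT⟩ | ⟨i', j', hik', hkj', hlt', hmin', hT⟩ |
      ⟨i', j', hkj', hlt', hlt2', hT⟩
  · exact inj _ _ (triple_eq hlt (lt _) hlt' hT).1
  · obtain ⟨h1, h2⟩ := triple_eq hlt (lt _) ((hmin' _ hkj').trans hlt') hT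
    obtain rfl := inj _ _ h1
    exact absurd (inj _ _ h2).symm (aux hkj hlt hlast hkj' hlt')
  · exact absurd hT (triple_ne_quadruple (lt _) hlt (lt _) hlt2' hlt')
  · obtain ⟨h1, h2⟩ := triple_eq ((hmin _ hkj).trans hlt) (lt _) hlt' hT
    obtain rfl := inj _ _ h1
    exact absurd (inj _ _ h2) (aux hkj' hlt' hlast' hkj hlt)
  · exact inj _ _ (triple_eq ((hmin _ hkj).trans hlt) (lt _)
      ((hmin' _ hkj').trans hlt') hT).2
  · exact absurd hT (triple_ne_quadruple (lt _) ((hmin _ hkj).trans hlt) (lt _) hlt2' hlt')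
  · exact absurd hT.symm (triple_ne_quadruple (lt _) hlt' (lt _) hlt2 hlt)
  · exact absurd hT.symm
      (triple_ne_quadruple (lt _) ((hmin' _ hkj').trans hlt') (lt _) hlt2 hlt)
  · exact inj _ _ (quadruple_min_eq (lt _) hlt2 hlt (lt _) hlt2' hlt' hT)

/-- The first two letters of a decreasing triple give an occurrence charged to no letter. -/
theorem not_isCharged {n : ℕ} {wbar : Equiv.Perm (Fin n)} {i j l k : Fin n}
    (hjl : j < l) (hji : wbar j < wbar i) (hlj : wbar l < wbar j) :
    ¬ IsCharged wbar k {n, (wbar i : ℕ), (wbar j : ℕ)} := by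
  have inj : ∀ a b : Fin n, (wbar a : ℕ) = wbar b → a = b := fun a b hab =>
    wbar.injective (Fin.ext hab)
  have lt : ∀ a, (wbar a : ℕ) < n := fun a => (wbar a).isLt
  rintro (⟨b, hkb, hlt, hlast, hT⟩ | ⟨a, b, hak, hkb, hlt, hmin, hT⟩ |
    ⟨a, b, hkb, hlt, hlt2, hT⟩)
  · obtain ⟨h1, h2⟩ := triple_eq hji (lt _) hlt hT
    obtain rfl := inj _ _ h1
    obtain rfl := inj _ _ h2
    exact lt_asymm (hlast l hjl) (hlj.trans hji)
  · obtain ⟨-, h2⟩ := triple_eq hji (lt _) ((hmin _ hkb).trans hlt) hT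
    obtain rfl := inj _ _ h2
    exact lt_asymm (hmin l hjl) hlj
  · exact triple_ne_quadruple (lt _) hji (lt _) hlt2 hlt hT

theorem IsDeletion.exists_isCharged {n : ℕ} {w : Equiv.Perm (Fin (n + 1))}
    {wbar : Equiv.Perm (Fin n)} (hdel : IsDeletion w wbar) {k : ℕ} (hk : k ∈ newrep w wbar) :
    ∃ (hkn : k < n) (T : Finset ℕ), IsCharged wbar ⟨k, hkn⟩ T ∧
      (IsTopOccSet p321 w T ∨ IsTopOccSet p3412 w T) := by
  obtain ⟨hsupp, hpos⟩ := hk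
  obtain ⟨a, b, hak, hkb, hlt⟩ := exists_inversion_of_mem_supp hsupp
  have hkn : k < n := by omega
  refine ⟨hkn, ?_⟩
  obtain ⟨κ, rfl⟩ : ∃ κ : Fin n, (κ : ℕ) = k := ⟨⟨k, hkn⟩, rfl⟩
  change ∃ T, IsCharged wbar κ T ∧ _
  by_cases hex : ∃ j, κ < j ∧ wbar j < wbar κ
  · obtain ⟨j, ⟨hkj, hjlt⟩, hmax⟩ :=
      (Set.toFinite {j | κ < j ∧ wbar j < wbar κ}).exists_maximal hex
    refine ⟨_, Or.inl ⟨j, hkj, hjlt, fun l hjl => ?_, rfl⟩,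
      Or.inl (hdel.isTopOccSet_p321 hpos hkj hjlt)⟩
    by_contra hle
    have hkl := hkj.trans hjl
    have hne : wbar l ≠ wbar κ := fun he => hkl.ne (wbar.injective he).symm
    exact absurd (hmax ⟨hkl, lt_of_le_of_ne (not_lt.1 hle) hne⟩ hjl.le) hjl.not_ge
  · push Not at hex
    have hmin : ∀ l, κ < l → wbar κ < wbar l := fun l hl =>
      lt_of_le_of_ne (hex l hl) fun he => hl.ne (wbar.injective he)
    have hkb' : κ < b := hkb
    have hne : a ≠ κ := by
      rintro rfl
      exact lt_asymm hlt (hmin b hkb')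
    have hak' : a < κ := lt_of_le_of_ne hak hne
    rcases lt_or_ge (a : ℕ) (posOf w n) with ha | ha
    · exact ⟨_, Or.inr (Or.inr ⟨a, b, hkb', hmin b hkb', hlt, rfl⟩),
        Or.inr (hdel.isTopOccSet_p3412 ha hpos hkb' (hmin b hkb') hlt)⟩
    · exact ⟨_, Or.inr (Or.inl ⟨a, b, hak', hkb', hlt, hmin, rfl⟩),
        Or.inl (hdel.isTopOccSet_p321 ha hak' ((hmin b hkb').trans hlt))⟩

/-- if `w` has an `N`-occurrence of 4321, then
`|newrep(w)| < [321;3412]_N(w)`. -/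
theorem newrep_card_lt_of_top_4321 {n : ℕ} (w : Equiv.Perm (Fin (n + 1)))
    (wbar : Equiv.Perm (Fin n)) (hdel : IsDeletion w wbar)
    (h4321 : ∃ S : Finset ℕ, IsTopOccSet p4321 w S) :
    (newrep w wbar).ncard < topOccCount p321 w + topOccCount p3412 w := by
  obtain ⟨i, j, l, hi, hij, hjl, hji, hlj⟩ := hdel.exists_decreasing h4321
  choose! hkn T hT hocc using fun k (hk : k ∈ newrep w wbar) => hdel.exists_isCharged hk
  have hinj : Set.InjOn T (newrep w wbar) := by
    intro k hk k' hk' he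
    have h := hT k hk
    rw [he] at h
    exact congrArg Fin.val (h.unique (hT k' hk'))
  have hfin := (finite_topOccSet p321 w).union (finite_topOccSet p3412 w)
  rw [← hinj.ncard_image]
  refine lt_of_lt_of_le (Set.ncard_lt_ncard ((Set.ssubset_iff_of_subset ?_).2 ?_) hfin)
    (Set.ncard_union_le _ _)
  · rintro _ ⟨k, hk, rfl⟩
    exact hocc k hk
  · refine ⟨_, Or.inl (hdel.isTopOccSet_p321 hi hij hji), ?_⟩
    rintro ⟨k, hk, he⟩
    have h := hT k hk
    rw [he] at h
    exact not_isCharged hjl hji hlj h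
end

section
/- Let w ∈ S_N. If some N-occurrence {N > a > b} of the pattern 321 in w satisfies b ∉ {m_k : k ∈ newrep(w)}, then w has an N-occurrence of the pattern 4321. -/
theorem exists_isWord {m : ℕ} (w : Equiv.Perm (Fin m)) : ∃ l : List ℕ, IsWord m l w := by
  rcases m with _ | m
  · exact ⟨[], by simp, Subsingleton.elim _ _⟩
  have hw : w ∈ Submonoid.closure
      (Set.range fun i : Fin m => Equiv.swap i.castSucc i.succ) := by
    rw [Equiv.Perm.mclosure_swap_castSucc_succ]; trivial
  induction hw using Submonoid.closure_induction with
  | mem x hx =>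
    obtain ⟨i, rfl⟩ := hx
    refine ⟨[i], by simp, ?_⟩
    have hi : (i : ℕ) + 1 < m + 1 := by omega
    simp only [List.map_cons, List.map_nil, List.prod_cons, List.prod_nil, mul_one, sr, dif_pos hi]
    rfl
  | one => exact ⟨[], by simp, rfl⟩
  | mul x y _ _ hx hy =>
    obtain ⟨l, hl, rfl⟩ := hx
    obtain ⟨l', hl', rfl⟩ := hy
    refine ⟨l ++ l', fun i hi => ?_, by simp⟩
    rcases List.mem_append.1 hi with h | h
    exacts [hl i h, hl' i h]

theorem exists_isReducedWord {m : ℕ} (w : Equiv.Perm (Fin m)) :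
    ∃ l : List ℕ, IsReducedWord w l := by
  obtain ⟨l, hl⟩ := exists_isWord w
  exact Nat.sInf_mem (s := {c | ∃ l : List ℕ, IsWord m l w ∧ l.length = c}) ⟨_, l, hl, rfl⟩

theorem sr_apply_le_iff {m i k : ℕ} (h : i ≠ k) (x : Fin m) :
    (sr m i x : ℕ) ≤ k ↔ (x : ℕ) ≤ k := by
  unfold sr
  split_ifs with hi
  · rw [Equiv.swap_apply_def]
    split_ifs with h1 h2
    · subst h1; simp only; omega
    · subst h2; simp only; omega
    · rfl
  · rfl

theorem prod_sr_apply_le_iff {m k : ℕ} (l : List ℕ) (hl : k ∉ l) (x : Fin m) :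
    ((l.map (sr m)).prod x : ℕ) ≤ k ↔ (x : ℕ) ≤ k := by
  induction l with
  | nil => simp
  | cons i l ih =>
    rw [List.mem_cons, not_or] at hl
    rw [List.map_cons, List.prod_cons, Equiv.Perm.mul_apply,
      sr_apply_le_iff (Ne.symm hl.1), ih hl.2]

/-- An inversion straddling the cut after position `k` forces `k` into the support. -/
theorem mem_supp_of_inversion {m k : ℕ} (w : Equiv.Perm (Fin m)) {i j : Fin m}
    (hi : (i : ℕ) ≤ k) (hj : k < (j : ℕ)) (hij : w j < w i) : k ∈ supp w := by
  obtain ⟨l, hl⟩ := exists_isReducedWord w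
  refine ⟨l, hl, ?_⟩
  by_contra hk
  have h1 := prod_sr_apply_le_iff l hk i
  have h2 := prod_sr_apply_le_iff l hk j
  rw [hl.1.2] at h1 h2
  rw [Fin.lt_def] at hij
  omega

theorem isTopOccSet_p4321 {n : ℕ} (w : Equiv.Perm (Fin (n + 1))) {i1 i2 i3 i4 : Fin (n + 1)}
    (h12 : i1 < i2) (h23 : i2 < i3) (h34 : i3 < i4) (htop : w i1 = Fin.last n)
    (hd1 : w i2 < w i1) (hd2 : w i3 < w i2) (hd3 : w i4 < w i3) :
    ∃ S : Finset ℕ, IsTopOccSet p4321 w S := by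
  refine ⟨_, ⟨![i1, i2, i3, i4], ?_, ?_, rfl⟩, ?_⟩
  · rw [Fin.strictMono_iff_lt_succ]
    intro i
    fin_cases i
    exacts [h12, h23, h34]
  · intro a b
    simp only [Fin.lt_def] at hd1 hd2 hd3 ⊢
    fin_cases a <;> fin_cases b <;> simp [p4321] <;> omega
  · exact Finset.mem_image.2 ⟨0, Finset.mem_univ _, by simp [htop]⟩

/-- if some `N`-occurrence `{N > a > b}` of 321 in `w` (at positions
`i1 < i2 < i3`, with `a = w i2`, `b = w i3`) has `b ∉ {m_k : k ∈ newrep(w)}`, then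
`w` has an `N`-occurrence of 4321. -/
theorem must_use_mstat {n : ℕ} (w : Equiv.Perm (Fin (n + 1)))
    (wbar : Equiv.Perm (Fin n)) (hdel : IsDeletion w wbar)
    (i1 i2 i3 : Fin (n + 1)) (h12 : i1 < i2) (h23 : i2 < i3)
    (htop : w i1 = Fin.last n) (hd1 : w i2 < w i1) (hd2 : w i3 < w i2)
    (hb : ¬ ∃ k ∈ newrep w wbar, (w i3 : ℕ) = mstat wbar k) :
    ∃ S : Finset ℕ, IsTopOccSet p4321 w S := by
  have hpos : posOf w n = i1 := by
    have : w⁻¹ (Fin.last n) = i1 := by rw [← htop]; simp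
    simp only [posOf, Nat.lt_succ_self, dif_pos]
    exact congrArg Fin.val this
  have hshift : ∀ (j : Fin (n + 1)) (hj : i1 < j),
      (wbar ⟨j - 1, by have := j.2; rw [Fin.lt_def] at hj; omega⟩ : ℕ) = w j := by
    intro j hj
    rw [Fin.lt_def] at hj
    have h1 : (j : ℕ) - 1 + 1 = j := by omega
    rw [hdel, hpos, if_neg (by simp only; omega)]
    rw [valAt, dif_pos (by simp only; omega)]
    simp only [h1]
  have h13 := h12.trans h23
  have e2 := hshift i2 h12
  have e3 := hshift i3 h13
  rw [Fin.lt_def] at h12 h23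
  have hmem : ((i3 : ℕ) - 2) ∈ newrep w wbar := by
    refine ⟨mem_supp_of_inversion wbar (i := ⟨i2 - 1, by omega⟩) (j := ⟨i3 - 1, by omega⟩)
      ?_ ?_ ?_, ?_⟩
    · simp only; omega
    · simp only; omega
    · rw [Fin.lt_def, e2, e3]; exact hd2
    · omega
  have hin : (w i3 : ℕ) ∈
      {v | ∃ i : Fin n, (i3 : ℕ) - 2 < (i : ℕ) ∧ (wbar i : ℕ) = v} :=
    ⟨_, by simp only; omega, e3⟩
  have hlt : mstat wbar (i3 - 2) < w i3 :=
    lt_of_le_of_ne (Nat.sInf_le hin) fun h => hb ⟨_, hmem, h.symm⟩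
  obtain ⟨i, hi, hv⟩ := Nat.sInf_mem ⟨_, hin⟩
  have e4 := hshift i.succ (by rw [Fin.lt_def, Fin.val_succ]; omega)
  simp only [Fin.val_succ, Nat.add_sub_cancel] at e4
  have hd3 : w i.succ < w i3 := by
    rw [Fin.lt_def, ← e4]
    exact hv.trans_lt hlt
  have h34 : i3 < i.succ := by
    refine lt_of_le_of_ne (by rw [Fin.le_def, Fin.val_succ]; omega) ?_
    rintro rfl
    exact hd3.false
  exact isTopOccSet_p4321 w h12 h23 h34 htop hd1 hd2 hd3
end
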